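/- Let k*, k** ∈ ℕ and ε ∈ (0,1/2). Then there exist N, k ∈ ℕ such that for every finite graph G having the non-k*-order property and the non-k**-tree property and every A ⊆ G with |A| ≥ N, there are m ≤ k and a partition ⟨A_i : i < m⟩ of A such that each A_i is ε-excellent and for all i < j < m: (1) ||A_i| − |A_j|| ≤ 1; (2) the pair (A_i, A_j) is ε-regular; and (3) for all B_i ⊆ A_i and B_j ⊆ A_j with |B_i| ≥ ε|A_i| and |B_j| ≥ ε|A_j|, either d(B_i,B_j) < ε or d(B_i,B_j) ≥ 1 − ε. -/

import Mathlib

open Finset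

open scoped Classical

namespace Paper

variable {V : Type}

/-- `G` has the `k`-order property. -/
def HasOrderProp (G : SimpleGraph V) (k : ℕ) : Prop :=
  ∃ a b : Fin k → V, ∀ i j : Fin k, i < j → G.Adj (a i) (b j) ∧ ¬ G.Adj (a j) (b i)

/-- `G` has the non-`k`-order property. -/
def NoOrderProp (G : SimpleGraph V) (k : ℕ) : Prop := ¬ HasOrderProp G k

/-- `G` has the non-`k`-tree property. -/
def NoTreeProp (G : SimpleGraph V) (k : ℕ) : Prop :=
  ¬ ∃ (a : (Fin k → Bool) → V) (b : (m : Fin k) → (Fin (m : ℕ) → Bool) → V),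
      ∀ (η : Fin k → Bool) (m : Fin k) (ρ : Fin (m : ℕ) → Bool),
        (∀ i : Fin (m : ℕ), η ⟨i.1, i.2.trans m.2⟩ = ρ i) →
        (G.Adj (a η) (b m ρ) ↔ η m = true)

/-- The truth value `t` is the `ζ`-average of the vertex `a` over the set `B`:
all but fewer than `ζ|B|` of the `b ∈ B` satisfy `(a R b) ≡ t`. -/
def AvgIs (G : SimpleGraph V) (ζ : ℝ) (B : Finset V) (a : V) (t : Bool) : Prop :=
  ((B.filter fun b => ¬ (G.Adj a b ↔ t = true)).card : ℝ) < ζ * B.card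

/-- `A` is `ε`-good. -/
def Good (G : SimpleGraph V) (ε : ℝ) (A : Finset V) : Prop :=
  ∀ b : V, ∃ t : Bool, AvgIs G ε A b t

/-- `A` is `(ε,ζ)`-excellent. -/
def Excellent (G : SimpleGraph V) (ε ζ : ℝ) (A : Finset V) : Prop :=
  Good G ε A ∧
    ∀ B : Finset V, Good G ζ B →
      ∃ t : Bool, ((A.filter fun a => ¬ AvgIs G ζ B a t).card : ℝ) < ε * A.card

/-- The pair `(A,B)` is `(ε,ζ)`-uniform. -/
def Uniform (G : SimpleGraph V) (ε ζ : ℝ) (A B : Finset V) : Prop :=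
  ∃ t : Bool, ((A.filter fun a => ¬ AvgIs G ζ B a t).card : ℝ) < ε * A.card

/-- `A` is `f`-indivisible. -/
def Indivisible (G : SimpleGraph V) (f : ℕ → ℕ) (A : Finset V) : Prop :=
  ∀ b : V, ∃ t : Bool, (A.filter fun a => ¬ (G.Adj a b ↔ t = true)).card < f A.card

/-- `A` is `ε`-indivisible, for a real `ε ∈ (0,1)`. -/
def EpsIndivisible (G : SimpleGraph V) (ε : ℝ) (A : Finset V) : Prop :=
  ∀ b : V, ∃ t : Bool,
    ((A.filter fun a => ¬ (G.Adj a b ↔ t = true)).card : ℝ) < (A.card : ℝ) ^ ε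

/-- The edge density between `A` and `B`. -/
noncomputable def density (G : SimpleGraph V) (A B : Finset V) : ℝ :=
  (((A ×ˢ B).filter fun p => G.Adj p.1 p.2).card : ℝ) / (A.card * B.card)

/-- The pair `(A,B)` is `ε`-regular. -/
def Regular (G : SimpleGraph V) (ε : ℝ) (A B : Finset V) : Prop :=
  ∀ A' ⊆ A, ∀ B' ⊆ B, ε * A.card ≤ (A'.card : ℝ) → ε * B.card ≤ (B'.card : ℝ) →
    |density G A B - density G A' B'| < ε

/-- The sequence `⟨a_i : i < n⟩` is `Δ_k`-indiscernible. -/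
def DeltaIndiscernible (G : SimpleGraph V) (k : ℕ) {n : ℕ} (a : Fin n → V) : Prop :=
  Function.Injective a ∧
  (∀ i₀ i₁ j₀ j₁ : Fin n, i₀ < i₁ → j₀ < j₁ →
    (G.Adj (a i₀) (a i₁) ↔ G.Adj (a j₀) (a j₁))) ∧
  (∀ m : ℕ, m ≤ k → ∀ i j : Fin k → Fin n, StrictMono i → StrictMono j →
    (((∃ y : V, (∀ ℓ : Fin k, (ℓ : ℕ) < m → G.Adj y (a (i ℓ))) ∧
                (∀ ℓ : Fin k, m ≤ (ℓ : ℕ) → ¬ G.Adj y (a (i ℓ)))) ↔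
      (∃ y : V, (∀ ℓ : Fin k, (ℓ : ℕ) < m → G.Adj y (a (j ℓ))) ∧
                (∀ ℓ : Fin k, m ≤ (ℓ : ℕ) → ¬ G.Adj y (a (j ℓ))))) ∧
     ((∃ y : V, (∀ ℓ : Fin k, (ℓ : ℕ) < m → ¬ G.Adj y (a (i ℓ))) ∧
                (∀ ℓ : Fin k, m ≤ (ℓ : ℕ) → G.Adj y (a (i ℓ)))) ↔
      (∃ y : V, (∀ ℓ : Fin k, (ℓ : ℕ) < m → ¬ G.Adj y (a (j ℓ))) ∧
                (∀ ℓ : Fin k, m ≤ (ℓ : ℕ) → G.Adj y (a (j ℓ)))))))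

variable {G : SimpleGraph V}

/-- `H` contains the leaves of a full binary tree of height `n` whose nodes are vertices. -/
def HasTree (G : SimpleGraph V) : ℕ → Set V → Prop
  | 0, H => H.Nonempty
  | n + 1, H => ∃ b, HasTree G n {a ∈ H | G.Adj a b} ∧ HasTree G n {a ∈ H | ¬ G.Adj a b}

/-- `s` is the multiset of leaves of a full binary tree of height `n` whose nodes are vertex sets,
the branching being decided by the `ε`-averages over these sets. -/
def AvgTree (G : SimpleGraph V) (ε : ℝ) : ℕ → Multiset V → Prop
  | 0, s => s.card = 1
  | n + 1, s => ∃ s₀ s₁ : Multiset V, ∃ B : Finset V, s = s₀ + s₁ ∧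
      AvgTree G ε n s₀ ∧ AvgTree G ε n s₁ ∧
      (∀ a ∈ s₀, AvgIs G ε B a false) ∧ ∀ a ∈ s₁, AvgIs G ε B a true

/-- The average over any `ζ`-good set is constant on `A`, up to fewer than `α|A|` exceptions. -/
def AlmostConstant (G : SimpleGraph V) (α ζ : ℝ) (A : Finset V) : Prop :=
  ∀ B : Finset V, Good G ζ B →
    ∃ t : Bool, ((A.filter fun a => ¬ AvgIs G ζ B a t).card : ℝ) < α * A.card

theorem HasTree.mono {n : ℕ} {H H' : Set V} (hHH' : H ⊆ H') (h : HasTree G n H) :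
    HasTree G n H' := by
  induction n generalizing H H' with
  | zero => exact Set.Nonempty.mono hHH' h
  | succ n ih =>
    obtain ⟨b, h1, h0⟩ := h
    exact ⟨b, ih (fun a ha => ⟨hHH' ha.1, ha.2⟩) h1, ih (fun a ha => ⟨hHH' ha.1, ha.2⟩) h0⟩

theorem HasTree.exists_labelling {n : ℕ} {H : Set V} (h : HasTree G n H) :
    ∃ (a : (Fin n → Bool) → V) (b : (m : Fin n) → (Fin (m : ℕ) → Bool) → V),
      (∀ η, a η ∈ H) ∧
      ∀ (η : Fin n → Bool) (m : Fin n) (ρ : Fin (m : ℕ) → Bool),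
        (∀ i : Fin (m : ℕ), η ⟨i.1, i.2.trans m.2⟩ = ρ i) →
        (G.Adj (a η) (b m ρ) ↔ η m = true) := by
  induction n generalizing H with
  | zero =>
    obtain ⟨a, ha⟩ := h
    exact ⟨fun _ => a, fun m => m.elim0, fun _ => ha, fun _ m => m.elim0⟩
  | succ n ih =>
    obtain ⟨b, h1, h0⟩ := h
    obtain ⟨a₁, b₁, ha₁, hb₁⟩ := ih h1
    obtain ⟨a₀, b₀, ha₀, hb₀⟩ := ih h0
    refine ⟨fun η => if η 0 = true then a₁ (Fin.tail η) else a₀ (Fin.tail η),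
      fun m => Fin.cases (motive := fun m => (Fin (m : ℕ) → Bool) → V) (fun _ => b)
        (fun m ρ => if ρ ⟨0, Nat.succ_pos _⟩ = true
          then b₁ m (fun i => ρ ⟨i + 1, Nat.succ_lt_succ i.2⟩)
          else b₀ m (fun i => ρ ⟨i + 1, Nat.succ_lt_succ i.2⟩)) m, ?_, ?_⟩
    · intro η
      dsimp only
      split_ifs
      · exact (ha₁ _).1
      · exact (ha₀ _).1
    · intro η m
      refine Fin.cases ?_ (fun m => ?_) m
      · intro ρ _
        by_cases h : η 0 = true
        · simp only [h, if_true, iff_true]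
          exact (ha₁ (Fin.tail η)).2
        · simp only [h, Bool.false_eq_true, if_false, iff_false]
          exact (ha₀ (Fin.tail η)).2
      · intro ρ hρ
        have hroot : η 0 = ρ ⟨0, Nat.succ_pos _⟩ := hρ ⟨0, Nat.succ_pos _⟩
        have htail : ∀ i : Fin (m : ℕ),
            Fin.tail η ⟨i.1, i.2.trans m.2⟩ = ρ ⟨i + 1, Nat.succ_lt_succ i.2⟩ :=
          fun i => hρ ⟨i + 1, Nat.succ_lt_succ i.2⟩
        simp only [Fin.cases_succ, ← hroot]
        by_cases h : η 0 = true
        · simp only [h, if_true]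
          exact hb₁ _ _ _ htail
        · simp only [h]
          exact hb₀ _ _ _ htail

theorem NoTreeProp.not_hasTree {n : ℕ} (h : NoTreeProp G n) : ¬ HasTree G n Set.univ := by
  intro hT
  obtain ⟨a, b, -, hab⟩ := hT.exists_labelling
  exact h ⟨a, b, hab⟩

theorem AvgIs.le_card_filter {ε : ℝ} {B : Finset V} {a : V} {t : Bool} (h : AvgIs G ε B a t) :
    (1 - ε) * B.card ≤ ((B.filter fun b => (G.Adj a b ↔ t = true)).card : ℝ) := by
  have := B.card_filter_add_card_filter_not (fun b => (G.Adj a b ↔ t = true))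
  have h' : ((B.filter fun b => ¬ (G.Adj a b ↔ t = true)).card : ℝ) < ε * B.card := h
  have : ((B.filter fun b => (G.Adj a b ↔ t = true)).card : ℝ)
    + ((B.filter fun b => ¬ (G.Adj a b ↔ t = true)).card : ℝ) = B.card := by exact_mod_cast this
  linarith

theorem AvgIs.unique {ε : ℝ} (hε : ε ≤ 1 / 2) {B : Finset V} {a : V} {t u : Bool}
    (ht : AvgIs G ε B a t) (hu : AvgIs G ε B a u) : t = u := by
  by_contra hne
  have h1 := ht.le_card_filter
  have h2 : ((B.filter fun b => ¬ (G.Adj a b ↔ u = true)).card : ℝ) < ε * B.card := hu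
  have h3 : (B.filter fun b => (G.Adj a b ↔ t = true)) =
      B.filter fun b => ¬ (G.Adj a b ↔ u = true) := by
    refine filter_congr fun b _ => ?_
    cases t <;> cases u <;> simp_all
  rw [h3] at h1
  have : (0 : ℝ) ≤ B.card := by positivity
  nlinarith

theorem AvgIs.mono {ε ε' : ℝ} (h : ε ≤ ε') {B : Finset V} {a : V} {t : Bool}
    (ht : AvgIs G ε B a t) : AvgIs G ε' B a t :=
  lt_of_lt_of_le ht (mul_le_mul_of_nonneg_right h (Nat.cast_nonneg _))

theorem Good.avgIs_not {ε : ℝ} {B : Finset V} (hB : Good G ε B) {a : V} {t : Bool}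
    (h : ¬ AvgIs G ε B a t) : AvgIs G ε B a (!t) := by
  obtain ⟨u, hu⟩ := hB a
  have : u ≠ t := fun e => h (e ▸ hu)
  rwa [← Bool.eq_not.2 this]

theorem Good.mono {ε ε' : ℝ} (h : ε ≤ ε') {B : Finset V} (hB : Good G ε B) : Good G ε' B :=
  fun a => (hB a).imp fun _ ht => ht.mono h

theorem AvgTree.card {ε : ℝ} {n : ℕ} {s : Multiset V} (h : AvgTree G ε n s) : s.card = 2 ^ n := by
  induction n generalizing s with
  | zero => exact h
  | succ n ih =>
    obtain ⟨s₀, s₁, B, rfl, h0, h1, -⟩ := h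
    rw [Multiset.card_add, ih h0, ih h1, pow_succ, mul_two]

theorem le_sum_countP {ε : ℝ} {B : Finset V} {t : Bool} (H : Set V) (H' : V → Set V)
    (hH' : ∀ a b, a ∈ H' b ↔ a ∈ H ∧ (G.Adj a b ↔ t = true)) {s : Multiset V}
    (hs : ∀ a ∈ s, AvgIs G ε B a t) :
    (1 - ε) * B.card * s.countP (· ∈ H) ≤ ∑ b ∈ B, (s.countP (· ∈ H' b) : ℝ) := by
  induction s using Multiset.induction with
  | empty => simp
  | cons a s ih =>
    have ih := ih fun x hx => hs x (Multiset.mem_cons_of_mem hx)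
    by_cases ha : a ∈ H
    · have := (hs a (Multiset.mem_cons_self a s)).le_card_filter
      rw [card_filter] at this
      push_cast at this
      simp only [Multiset.countP_cons, ha, hH' a, true_and, if_true, Nat.cast_add, sum_add_distrib]
      push_cast
      linarith
    · simpa [Multiset.countP_cons, ha, hH' a] using ih

/-- A sequential version of the Sauer–Shelah lemma, for trees of averages. -/
theorem AvgTree.countP_le {ε : ℝ} (hε : ε < 1) {n d : ℕ} {s : Multiset V} {H : Set V}
    (hs : AvgTree G ε n s) (hH : ¬ HasTree G d H) :
    (s.countP (· ∈ H) : ℝ) * (1 - ε) ^ n ≤ ((n : ℝ) + 1) ^ d := by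
  induction n generalizing s d H with
  | zero =>
    have : (s.countP (· ∈ H) : ℝ) ≤ 1 := by
      exact_mod_cast (Multiset.countP_le_card _ _).trans hs.card.le
    simpa using this
  | succ n ih =>
    cases d with
    | zero =>
      have : s.countP (· ∈ H) = 0 := by
        rw [Multiset.countP_eq_zero]
        exact fun a _ ha => hH ⟨a, ha⟩
      simp [this]
    | succ d =>
      obtain ⟨s₀, s₁, B, rfl, h0, h1, hB0, hB1⟩ := hs
      have hBne : B.Nonempty := by
        have : 0 < s₀.card := by rw [h0.card]; positivity
        obtain ⟨a, ha⟩ := Multiset.card_pos_iff_exists_mem.1 this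
        rw [nonempty_iff_ne_empty]
        rintro rfl
        simpa [AvgIs] using hB0 a ha
      obtain ⟨H₀, hH₀⟩ : ∃ H₀ : V → Set V, ∀ b, H₀ b = {a ∈ H | ¬ G.Adj a b} := ⟨_, fun _ => rfl⟩
      obtain ⟨H₁, hH₁⟩ : ∃ H₁ : V → Set V, ∀ b, H₁ b = {a ∈ H | G.Adj a b} := ⟨_, fun _ => rfl⟩
      have key0 := le_sum_countP H H₀ (fun a b => by simp [hH₀]) hB0
      have key1 := le_sum_countP H H₁ (fun a b => by simp [hH₁]) hB1
      obtain ⟨b, -, hb⟩ := exists_le_of_sum_le (s := B)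
        (f := fun _ => (1 - ε) * ((s₀ + s₁).countP (· ∈ H) : ℝ))
        (g := fun b => (s₀.countP (· ∈ H₀ b) : ℝ) + s₁.countP (· ∈ H₁ b)) hBne (by
          rw [sum_add_distrib, sum_const, nsmul_eq_mul, Multiset.countP_add, Nat.cast_add]
          linarith)
      have hpos : 0 ≤ (1 - ε) ^ n := pow_nonneg (by linarith) _
      have hstep : ((s₀ + s₁).countP (· ∈ H) : ℝ) * (1 - ε) ^ (n + 1) ≤
          s₀.countP (· ∈ H₀ b) * (1 - ε) ^ n +
          s₁.countP (· ∈ H₁ b) * (1 - ε) ^ n := by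
        calc _ = (1 - ε) * ((s₀ + s₁).countP (· ∈ H) : ℝ) * (1 - ε) ^ n := by ring
          _ ≤ _ := mul_le_mul_of_nonneg_right hb hpos
          _ = _ := by ring
      have hsum : ((n : ℝ) + 1) ^ (d + 1) + ((n : ℝ) + 1) ^ d ≤ ((n + 1 : ℕ) + 1 : ℝ) ^ (d + 1) := by
        have : ((n : ℝ) + 1) ^ d ≤ ((n : ℝ) + 2) ^ d := by gcongr; norm_num
        calc _ = ((n : ℝ) + 1) ^ d * (n + 2) := by ring
          _ ≤ ((n : ℝ) + 2) ^ d * (n + 2) := by gcongr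
          _ = _ := by push_cast; ring
      have hH0 : ¬ HasTree G (d + 1) (H₀ b) := fun h => hH (h.mono (hH₀ b ▸ fun _ h => h.1))
      have hH1 : ¬ HasTree G (d + 1) (H₁ b) := fun h => hH (h.mono (hH₁ b ▸ fun _ h => h.1))
      by_cases hd : HasTree G d (H₁ b)
      · have hd' : ¬ HasTree G d (H₀ b) := fun h => hH ⟨b, hH₁ b ▸ hd, hH₀ b ▸ h⟩
        linarith [ih h0 hd', ih h1 hH1]
      · linarith [ih h1 hd, ih h0 hH0]

theorem NoTreeProp.not_avgTree {ε : ℝ} (hε : ε < 1) {d n : ℕ} (h : NoTreeProp G d)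
    (hn : ((n : ℝ) + 1) ^ d < (2 * (1 - ε)) ^ n) (s : Multiset V) : ¬ AvgTree G ε n s := by
  intro hs
  obtain ⟨U, hU⟩ : ∃ U : Set V, U = Set.univ := ⟨_, rfl⟩
  have := hs.countP_le (H := U) hε (hU ▸ h.not_hasTree)
  rw [Multiset.countP_eq_card.2 fun _ _ => hU ▸ Set.mem_univ _, hs.card] at this
  rw [mul_pow] at hn
  push_cast at this
  linarith

theorem exists_almostConstant {ε α : ℝ} (hα0 : 0 < α) (hα1 : α ≤ 1) {n : ℕ} {A : Finset V}
    (hA : A.Nonempty) (hn : ∀ s : Multiset V, (∀ a ∈ s, a ∈ A) → ¬ AvgTree G ε n s) :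
    ∃ X ⊆ A, α ^ n * A.card ≤ X.card ∧ AlmostConstant G α ε X := by
  induction n generalizing A with
  | zero =>
    obtain ⟨a, ha⟩ := hA
    exact (hn {a} (by simpa using ha) (by simp [AvgTree])).elim
  | succ n ih =>
    by_cases hc : AlmostConstant G α ε A
    · exact ⟨A, Subset.rfl, mul_le_of_le_one_left (by positivity) (pow_le_one₀ hα0.le hα1), hc⟩
    by_contra! hno
    simp only [AlmostConstant, not_forall, not_exists, not_lt] at hc
    obtain ⟨B, hB, hc⟩ := hc
    have hpos : (0 : ℝ) < A.card := by exact_mod_cast hA.card_pos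
    have hsub : ∀ t, ∃ s : Multiset V, (∀ a ∈ s, a ∈ A.filter fun a => ¬ AvgIs G ε B a t) ∧
        AvgTree G ε n s := by
      intro t
      by_contra! hs
      have hne : (A.filter fun a => ¬ AvgIs G ε B a t).Nonempty := by
        rw [← card_pos]
        exact_mod_cast (mul_pos hα0 hpos).trans_le (hc t)
      obtain ⟨X, hX, hcard, hXc⟩ := ih hne hs
      refine hno X (hX.trans (filter_subset _ _)) (le_trans ?_ hcard) hXc
      calc α ^ (n + 1) * A.card = α ^ n * (α * A.card) := by ring
        _ ≤ _ := by gcongr; exact hc t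
    obtain ⟨s₀, hs₀, h0⟩ := hsub true
    obtain ⟨s₁, hs₁, h1⟩ := hsub false
    refine hn (s₀ + s₁) ?_ ⟨s₀, s₁, B, rfl, h0, h1,
      fun a ha => hB.avgIs_not (mem_filter.1 (hs₀ a ha)).2,
      fun a ha => hB.avgIs_not (mem_filter.1 (hs₁ a ha)).2⟩
    intro a ha
    rcases Multiset.mem_add.1 ha with h | h
    · exact (mem_filter.1 (hs₀ a h)).1
    · exact (mem_filter.1 (hs₁ a h)).1

theorem exists_avgTree_of_shattered {ε : ℝ} {t : Bool} {n : ℕ} {Y : Finset V} (hY : 2 ^ n ≤ Y.card)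
    (h : ∀ Z ⊆ Y, ∃ B, Good G ε B ∧ ∀ a ∈ Y, a ∈ Z ↔ ¬ AvgIs G ε B a t) :
    ∃ s : Multiset V, (∀ a ∈ s, a ∈ Y) ∧ AvgTree G ε n s := by
  induction n generalizing Y with
  | zero =>
    obtain ⟨a, ha⟩ := card_pos.1 (show 0 < Y.card by simpa using hY)
    exact ⟨{a}, by simpa using ha, by simp [AvgTree]⟩
  | succ n ih =>
    have hsub : ∀ W ⊆ Y, 2 ^ n ≤ W.card → ∃ s : Multiset V, (∀ a ∈ s, a ∈ W) ∧ AvgTree G ε n s := by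
      intro W hW hcard
      refine ih hcard fun Z hZ => ?_
      obtain ⟨B, hB, hBZ⟩ := h Z (hZ.trans hW)
      exact ⟨B, hB, fun a ha => hBZ a (hW ha)⟩
    obtain ⟨Z, hZY, hZ⟩ := exists_subset_card_eq (s := Y) (n := 2 ^ n)
      (le_trans (Nat.pow_le_pow_right two_pos n.le_succ) hY)
    obtain ⟨B, hB, hBZ⟩ := h Z hZY
    obtain ⟨s, hs, hsT⟩ := hsub Z hZY hZ.ge
    obtain ⟨s', hs', hsT'⟩ := hsub (Y \ Z) sdiff_subset (by
      rw [card_sdiff_of_subset hZY, hZ]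
      rw [pow_succ] at hY
      omega)
    have hsB : ∀ a ∈ s, AvgIs G ε B a (!t) := fun a ha =>
      hB.avgIs_not ((hBZ a (hZY (hs a ha))).1 (hs a ha))
    have hsB' : ∀ a ∈ s', AvgIs G ε B a t := fun a ha => by
      have ha := mem_sdiff.1 (hs' a ha)
      exact not_not.1 fun h => ha.2 ((hBZ a ha.1).2 h)
    have hmem : ∀ a ∈ s + s', a ∈ Y := fun a ha => by
      rcases Multiset.mem_add.1 ha with h | h
      · exact hZY (hs a h)
      · exact sdiff_subset (hs' a h)
    refine ⟨s + s', hmem, ?_⟩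
    cases t
    · exact ⟨s', s, B, add_comm _ _, hsT', hsT, hsB', hsB⟩
    · exact ⟨s, s', B, rfl, hsT, hsT', hsB, hsB'⟩

theorem card_le_of_not_shatters {X : Finset V} {v : ℕ} {𝒜 : Finset (Finset V)}
    (hX : ∀ F ∈ 𝒜, F ⊆ X) (hv : ∀ Y ⊆ X, v ≤ Y.card → ¬ 𝒜.Shatters Y) :
    𝒜.card ≤ v * (X.card + 1) ^ v := by
  calc 𝒜.card ≤ 𝒜.shatterer.card := card_le_card_shatterer 𝒜
    _ ≤ ((range v).biUnion fun i => X.powersetCard i).card := by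
      refine card_le_card fun Y hY => ?_
      have hY := mem_shatterer.1 hY
      obtain ⟨F, hF, hYF⟩ := hY.exists_superset
      have hYX := hYF.trans (hX F hF)
      simp only [mem_biUnion, mem_range, mem_powersetCard]
      exact ⟨Y.card, not_le.1 fun h => hv Y hYX h hY, hYX, rfl⟩
    _ ≤ ∑ i ∈ range v, (X.powersetCard i).card := card_biUnion_le
    _ ≤ (range v).card • (X.card + 1) ^ v := by
      refine sum_le_card_nsmul _ _ _ fun i hi => ?_
      rw [card_powersetCard]
      calc X.card.choose i ≤ X.card ^ i := Nat.choose_le_pow _ _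
        _ ≤ (X.card + 1) ^ i := Nat.pow_le_pow_left (Nat.le_succ _) _
        _ ≤ (X.card + 1) ^ v := Nat.pow_le_pow_right (Nat.succ_pos _) (mem_range.1 hi).le
    _ = v * (X.card + 1) ^ v := by simp

theorem card_exceptional_le [Fintype V] {ε : ℝ} {n : ℕ} (X : Finset V) (t : Bool)
    (hn : ∀ s : Multiset V, ¬ AvgTree G ε n s) :
    ((univ.filter (Good G ε)).image fun B => X.filter fun a => ¬ AvgIs G ε B a t).card ≤
      2 ^ n * (X.card + 1) ^ 2 ^ n := by
  refine card_le_of_not_shatters ?_ ?_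
  · intro F hF
    obtain ⟨B, -, rfl⟩ := mem_image.1 hF
    exact filter_subset _ _
  · intro Y hYX hY hsh
    obtain ⟨s, -, hs⟩ := exists_avgTree_of_shattered (G := G) (ε := ε) (t := t) hY (by
      intro Z hZ
      obtain ⟨F, hF, hYF⟩ := hsh hZ
      obtain ⟨B, hB, rfl⟩ := mem_image.1 hF
      refine ⟨B, (mem_filter.1 hB).2, fun a ha => ?_⟩
      rw [← hYF]
      simp [ha, hYX ha])
    exact hn s hs

theorem exists_subset_sum_exp_le {α : ℝ} {X : Finset V} {𝒜 : Finset (Finset V)} {c : ℕ}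
    (h𝒜 : ∀ F ∈ 𝒜, ((X ∩ F).card : ℝ) ≤ α * X.card) (hc : 2 * c ≤ X.card) :
    ∃ S ⊆ X, S.card = c ∧
      ∑ F ∈ 𝒜, Real.exp ((S ∩ F).card) ≤ 𝒜.card * Real.exp (4 * α * c) := by
  induction c with
  | zero => exact ⟨∅, empty_subset _, rfl, by simp⟩
  | succ c ih =>
    obtain ⟨S, hSX, hSc, hS⟩ := ih (by omega)
    have hcard : (X \ S).card = X.card - c := by rw [card_sdiff_of_subset hSX, hSc]
    have hne : (X \ S).Nonempty := card_pos.1 (by omega)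
    have hhalf : (X.card : ℝ) ≤ 2 * (X \ S).card := by
      rw [hcard]; exact_mod_cast (by omega : X.card ≤ 2 * (X.card - c))
    have hone : ∀ F ∈ 𝒜, ∑ x ∈ X \ S, Real.exp ((insert x S ∩ F).card) ≤
        (X \ S).card * (Real.exp (4 * α) * Real.exp ((S ∩ F).card)) := by
      intro F hF
      have hterm : ∀ x ∈ X \ S, Real.exp ((insert x S ∩ F).card) =
          Real.exp ((S ∩ F).card) * (1 + if x ∈ F then Real.exp 1 - 1 else 0) := by
        intro x hx
        by_cases hxF : x ∈ F
        · rw [insert_inter_of_mem hxF, card_insert_of_notMem (by simp [(mem_sdiff.1 hx).2])]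
          simp [hxF, Real.exp_add]
        · simp [insert_inter_of_notMem hxF, hxF]
      rw [sum_congr rfl hterm, ← mul_sum, sum_add_distrib, ← sum_filter, sum_const, sum_const,
        nsmul_eq_mul, nsmul_eq_mul]
      have hle : (((X \ S).filter (· ∈ F)).card : ℝ) ≤ α * (2 * (X \ S).card) := by
        have h1 : (((X \ S).filter (· ∈ F)).card : ℝ) ≤ (X ∩ F).card := by
          exact_mod_cast card_le_card fun x hx => by
            simp only [mem_filter, mem_sdiff] at hx
            exact mem_inter.2 ⟨hx.1.1, hx.2⟩
        have hα : 0 ≤ α := by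
          have h2 : (0 : ℝ) < X.card := by
            exact_mod_cast (by omega : 0 < X.card)
          exact nonneg_of_mul_nonneg_left ((Nat.cast_nonneg _).trans (h𝒜 F hF)) h2
        exact h1.trans ((h𝒜 F hF).trans (mul_le_mul_of_nonneg_left hhalf hα))
      have he : Real.exp 1 - 1 ≤ 2 := by linarith [Real.exp_one_lt_d9]
      have he' : 4 * α + 1 ≤ Real.exp (4 * α) := Real.add_one_le_exp _
      have hm : (((X \ S).filter (· ∈ F)).card : ℝ) * (Real.exp 1 - 1) ≤
          α * (2 * (X \ S).card) * 2 :=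
        mul_le_mul hle he (by linarith [Real.add_one_le_exp 1]) ((Nat.cast_nonneg _).trans hle)
      calc _ ≤ Real.exp ((S ∩ F).card) * ((X \ S).card * (4 * α + 1)) := by
            gcongr; linarith
        _ ≤ Real.exp ((S ∩ F).card) * ((X \ S).card * Real.exp (4 * α)) := by gcongr
        _ = _ := by ring
    obtain ⟨x, hx, hxle⟩ := exists_le_of_sum_le (s := X \ S)
      (f := fun x => ∑ F ∈ 𝒜, Real.exp ((insert x S ∩ F).card))
      (g := fun _ => Real.exp (4 * α) * ∑ F ∈ 𝒜, Real.exp ((S ∩ F).card)) hne (by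
        rw [sum_comm, sum_const, nsmul_eq_mul, mul_sum, mul_sum]
        exact sum_le_sum hone)
    obtain ⟨hxX, hxS⟩ := mem_sdiff.1 hx
    refine ⟨insert x S, insert_subset hxX hSX, by rw [card_insert_of_notMem hxS, hSc], ?_⟩
    calc _ ≤ _ := hxle
      _ ≤ Real.exp (4 * α) * (𝒜.card * Real.exp (4 * α * c)) := by gcongr
      _ = 𝒜.card * (Real.exp (4 * α) * Real.exp (4 * α * c)) := by ring
      _ = _ := by rw [← Real.exp_add]; congr 2; push_cast; ring

theorem AlmostConstant.exists_subset [Fintype V] {ε β : ℝ} {n c : ℕ} {X : Finset V}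
    (hX : AlmostConstant G (β / 8) ε X) (hn : ∀ s : Multiset V, ¬ AvgTree G ε n s)
    (hc : 2 * c ≤ X.card)
    (hexp : 2 * (2 ^ n * ((X.card : ℝ) + 1) ^ 2 ^ n) < Real.exp (β / 2 * c)) :
    ∃ S ⊆ X, S.card = c ∧ AlmostConstant G β ε S := by
  set ℱ : Bool → Finset (Finset V) := fun t =>
    (univ.filter (Good G ε)).image fun B => X.filter fun a => ¬ AvgIs G ε B a t
  set 𝒜 := (ℱ true ∪ ℱ false).filter fun F => (F.card : ℝ) < β / 8 * X.card
  have h𝒜 : (𝒜.card : ℝ) ≤ 2 * (2 ^ n * ((X.card : ℝ) + 1) ^ 2 ^ n) := by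
    have h1 : 𝒜.card ≤ (ℱ true).card + (ℱ false).card :=
      (card_filter_le _ _).trans (card_union_le _ _)
    have h2 : (ℱ true).card ≤ _ := card_exceptional_le X true hn
    have h3 : (ℱ false).card ≤ _ := card_exceptional_le X false hn
    exact_mod_cast (by omega : 𝒜.card ≤ 2 * (2 ^ n * (X.card + 1) ^ 2 ^ n))
  obtain ⟨S, hSX, hSc, hS⟩ := exists_subset_sum_exp_le (α := β / 8) (X := X) (𝒜 := 𝒜) (c := c)
    (fun F hF => le_trans (by exact_mod_cast card_le_card inter_subset_right)
      (mem_filter.1 hF).2.le) hc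
  refine ⟨S, hSX, hSc, fun B hB => ?_⟩
  obtain ⟨t, ht⟩ := hX B hB
  refine ⟨t, ?_⟩
  have hF : (X.filter fun a => ¬ AvgIs G ε B a t) ∈ 𝒜 := by
    refine mem_filter.2 ⟨?_, ht⟩
    have : (X.filter fun a => ¬ AvgIs G ε B a t) ∈ ℱ t :=
      mem_image.2 ⟨B, mem_filter.2 ⟨mem_univ _, hB⟩, rfl⟩
    cases t
    · exact mem_union_right _ this
    · exact mem_union_left _ this
  have hinter : S ∩ (X.filter fun a => ¬ AvgIs G ε B a t) = S.filter fun a => ¬ AvgIs G ε B a t := by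
    rw [inter_filter, inter_eq_left.2 hSX]
  have hlt : Real.exp ((S.filter fun a => ¬ AvgIs G ε B a t).card) < Real.exp (β * c) := by
    calc Real.exp ((S.filter fun a => ¬ AvgIs G ε B a t).card)
        ≤ ∑ F ∈ 𝒜, Real.exp ((S ∩ F).card) := by
          rw [← hinter]
          exact single_le_sum (f := fun F => Real.exp ((S ∩ F).card))
            (fun _ _ => (Real.exp_pos _).le) hF
      _ ≤ 𝒜.card * Real.exp (4 * (β / 8) * c) := hS
      _ < Real.exp (β / 2 * c) * Real.exp (4 * (β / 8) * c) :=
          mul_lt_mul_of_pos_right (h𝒜.trans_lt hexp) (Real.exp_pos _)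
      _ = Real.exp (β * c) := by rw [← Real.exp_add]; congr 1; ring
  rw [hSc]
  exact Real.exp_lt_exp.1 hlt

theorem good_singleton {ε : ℝ} (hε : 0 < ε) (b : V) : Good G ε {b} := by
  intro a
  by_cases h : G.Adj a b
  · exact ⟨true, by simpa [AvgIs, filter_singleton, h] using hε⟩
  · exact ⟨false, by simpa [AvgIs, filter_singleton, h] using hε⟩

theorem avgIs_singleton {ε : ℝ} (hε : ε ≤ 1) {a b : V} {t : Bool} (h : AvgIs G ε {b} a t) :
    G.Adj a b ↔ t = true := by
  by_contra hne
  have : (1 : ℝ) < ε := by simpa [AvgIs, filter_singleton, hne] using h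
  linarith

theorem AlmostConstant.good {α ζ : ℝ} (hζ0 : 0 < ζ) (hζ1 : ζ ≤ 1) {A : Finset V}
    (h : AlmostConstant G α ζ A) : Good G α A := by
  intro b
  obtain ⟨t, ht⟩ := h {b} (good_singleton hζ0 b)
  refine ⟨t, lt_of_le_of_lt ?_ ht⟩
  gcongr with a
  intro ha
  rw [SimpleGraph.adj_comm]
  exact avgIs_singleton hζ1 ha

theorem AlmostConstant.excellent {α ζ : ℝ} (hζ0 : 0 < ζ) (hζ1 : ζ ≤ 1) (hα : α ≤ ζ)
    {A : Finset V} (h : AlmostConstant G α ζ A) : Excellent G ζ ζ A :=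
  ⟨(h.good hζ0 hζ1).mono hα, fun B hB => (h B hB).imp fun _ ht =>
    lt_of_lt_of_le ht (mul_le_mul_of_nonneg_right hα (Nat.cast_nonneg _))⟩

theorem AlmostConstant.union {β γ ζ : ℝ} (hβ : 0 ≤ β) {S R : Finset V}
    (hS : AlmostConstant G β ζ S) (hR : (R.card : ℝ) ≤ γ * S.card) :
    AlmostConstant G (β + γ) ζ (S ∪ R) := by
  intro B hB
  obtain ⟨t, ht⟩ := hS B hB
  refine ⟨t, ?_⟩
  have hle : (((S ∪ R).filter fun a => ¬ AvgIs G ζ B a t).card : ℝ) ≤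
      (S.filter fun a => ¬ AvgIs G ζ B a t).card + R.card := by
    rw [filter_union]
    exact_mod_cast (card_union_le _ _).trans (Nat.add_le_add_left (card_filter_le _ _) _)
  have hSU : (S.card : ℝ) ≤ (S ∪ R).card := by exact_mod_cast card_le_card subset_union_left
  have hγ : 0 ≤ β + γ ∨ S.card = 0 := by
    rcases Nat.eq_zero_or_pos S.card with h | h
    · exact Or.inr h
    · have : (0 : ℝ) < S.card := by exact_mod_cast h
      have := nonneg_of_mul_nonneg_left ((Nat.cast_nonneg _).trans hR) this
      exact Or.inl (by linarith)
  rcases hγ with hγ | h0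
  · calc _ ≤ _ := hle
      _ < β * S.card + γ * S.card := by linarith
      _ = (β + γ) * S.card := by ring
      _ ≤ _ := by gcongr
  · have : (0 : ℝ) ≤ (S.filter fun a => ¬ AvgIs G ζ B a t).card := Nat.cast_nonneg _
    rw [h0] at ht
    norm_num at ht
    linarith

/-- Two almost constant sets are almost fully connected or almost fully disconnected. -/
theorem card_disagree_le {θ ζ : ℝ} (hζ0 : 0 < ζ) (hζ1 : ζ < 1 / 2) (hθ0 : 0 ≤ θ) (hθ : θ ≤ ζ)
    {A B : Finset V} (hA : AlmostConstant G θ ζ A) (hB : AlmostConstant G θ ζ B) :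
    ∃ t : Bool, (((A ×ˢ B).filter fun p => ¬ (G.Adj p.1 p.2 ↔ t = true)).card : ℝ) ≤
      2 * θ * (A.card * B.card) := by
  have hBg : Good G θ B := hB.good hζ0 (by linarith)
  obtain ⟨t, ht⟩ := hA B (hBg.mono hθ)
  refine ⟨t, ?_⟩
  rw [card_filter, sum_product]
  push_cast
  have hrow : ∀ a ∈ A, ∑ b ∈ B, (if ¬ (G.Adj a b ↔ t = true) then (1 : ℝ) else 0) ≤
      θ * B.card + if ¬ AvgIs G ζ B a t then (B.card : ℝ) else 0 := by
    intro a _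
    rw [← sum_filter, sum_const, nsmul_one]
    by_cases h : ¬ AvgIs G ζ B a t
    · rw [if_pos h]
      have : ((B.filter fun b => ¬ (G.Adj a b ↔ t = true)).card : ℝ) ≤ B.card := by
        exact_mod_cast card_filter_le _ _
      have : 0 ≤ θ * B.card := by positivity
      linarith
    · obtain ⟨u, hu⟩ := hBg a
      have : u = t := (hu.mono hθ).unique hζ1.le (not_not.1 h)
      subst this
      rw [if_neg h, add_zero]
      exact hu.le
  calc _ ≤ ∑ a ∈ A, (θ * B.card + if ¬ AvgIs G ζ B a t then (B.card : ℝ) else 0) :=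
        sum_le_sum hrow
    _ = A.card * (θ * B.card) + (A.filter fun a => ¬ AvgIs G ζ B a t).card * B.card := by
        rw [sum_add_distrib, ← sum_filter, sum_const, sum_const, nsmul_eq_mul, nsmul_eq_mul]
    _ ≤ A.card * (θ * B.card) + θ * A.card * B.card := by gcongr
    _ = _ := by ring

theorem density_le_of_disagree {δ : ℝ} {A B : Finset V} (hA : 0 < A.card) (hB : 0 < B.card)
    (h : (((A ×ˢ B).filter fun p => ¬ (G.Adj p.1 p.2 ↔ false = true)).card : ℝ) ≤
      δ * (A.card * B.card)) : density G A B ≤ δ := by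
  have : (0 : ℝ) < A.card * B.card := by exact_mod_cast Nat.mul_pos hA hB
  rw [density, div_le_iff₀ this]
  simpa using h

theorem le_density_of_disagree {δ : ℝ} {A B : Finset V} (hA : 0 < A.card) (hB : 0 < B.card)
    (h : (((A ×ˢ B).filter fun p => ¬ (G.Adj p.1 p.2 ↔ true = true)).card : ℝ) ≤
      δ * (A.card * B.card)) : 1 - δ ≤ density G A B := by
  have : (0 : ℝ) < A.card * B.card := by exact_mod_cast Nat.mul_pos hA hB
  rw [density, le_div_iff₀ this]
  have hsum := (A ×ˢ B).card_filter_add_card_filter_not (fun p => G.Adj p.1 p.2)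
  rw [card_product] at hsum
  have hsum : (((A ×ˢ B).filter fun p => G.Adj p.1 p.2).card : ℝ) +
    ((A ×ˢ B).filter fun p => ¬ G.Adj p.1 p.2).card = A.card * B.card := by exact_mod_cast hsum
  simp only [iff_true] at h
  linarith

theorem density_nonneg (A B : Finset V) : 0 ≤ density G A B := by
  unfold density; positivity

theorem density_le_one (A B : Finset V) : density G A B ≤ 1 := by
  refine div_le_one_of_le₀ ?_ (by positivity)
  exact_mod_cast (card_filter_le _ _).trans (card_product A B).le

theorem density_dichotomy {ε : ℝ} (hε0 : 0 < ε) (hε1 : ε < 1 / 2) {A B : Finset V}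
    (hA0 : 0 < A.card) (hB0 : 0 < B.card)
    (hA : AlmostConstant G (ε ^ 3 / 4) ε A) (hB : AlmostConstant G (ε ^ 3 / 4) ε B) :
    (∀ A' ⊆ A, ∀ B' ⊆ B, ε * A.card ≤ (A'.card : ℝ) → ε * B.card ≤ (B'.card : ℝ) →
      density G A' B' ≤ ε / 2) ∨
    ∀ A' ⊆ A, ∀ B' ⊆ B, ε * A.card ≤ (A'.card : ℝ) → ε * B.card ≤ (B'.card : ℝ) →
      1 - ε / 2 ≤ density G A' B' := by
  have hθ : ε ^ 3 / 4 ≤ ε := by nlinarith [mul_pos hε0 hε0]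
  obtain ⟨t, ht⟩ := card_disagree_le hε0 hε1 (by positivity) hθ hA hB
  have hA0' : (0 : ℝ) < A.card := by exact_mod_cast hA0
  have hB0' : (0 : ℝ) < B.card := by exact_mod_cast hB0
  have key : ∀ A' ⊆ A, ∀ B' ⊆ B, ε * A.card ≤ (A'.card : ℝ) → ε * B.card ≤ (B'.card : ℝ) →
      0 < A'.card ∧ 0 < B'.card ∧
      (((A' ×ˢ B').filter fun p => ¬ (G.Adj p.1 p.2 ↔ t = true)).card : ℝ) ≤
        ε / 2 * (A'.card * B'.card) := by
    intro A' hA' B' hB' hcA hcB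
    have hA1 : (0 : ℝ) < A'.card := (mul_pos hε0 hA0').trans_le hcA
    have hB1 : (0 : ℝ) < B'.card := (mul_pos hε0 hB0').trans_le hcB
    refine ⟨by exact_mod_cast hA1, by exact_mod_cast hB1, ?_⟩
    calc _ ≤ (((A ×ˢ B).filter fun p => ¬ (G.Adj p.1 p.2 ↔ t = true)).card : ℝ) := by
          exact_mod_cast card_le_card (filter_subset_filter _ (product_subset_product hA' hB'))
      _ ≤ 2 * (ε ^ 3 / 4) * (A.card * B.card) := ht
      _ = ε / 2 * ((ε * A.card) * (ε * B.card)) := by ring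
      _ ≤ _ := by gcongr
  cases t
  · exact Or.inl fun A' hA' B' hB' hcA hcB =>
      let ⟨h1, h2, h3⟩ := key A' hA' B' hB' hcA hcB
      density_le_of_disagree h1 h2 h3
  · exact Or.inr fun A' hA' B' hB' hcA hcB =>
      let ⟨h1, h2, h3⟩ := key A' hA' B' hB' hcA hcB
      le_density_of_disagree h1 h2 h3

theorem regular_and_density {ε : ℝ} (hε0 : 0 < ε) (hε1 : ε < 1 / 2) {A B : Finset V}
    (hA0 : 0 < A.card) (hB0 : 0 < B.card)
    (hA : AlmostConstant G (ε ^ 3 / 4) ε A) (hB : AlmostConstant G (ε ^ 3 / 4) ε B) :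
    Regular G ε A B ∧ ∀ A' ⊆ A, ∀ B' ⊆ B,
      ε * A.card ≤ (A'.card : ℝ) → ε * B.card ≤ (B'.card : ℝ) →
        density G A' B' < ε ∨ 1 - ε ≤ density G A' B' := by
  have hself : ∀ C : Finset V, ε * C.card ≤ (C.card : ℝ) := fun C =>
    mul_le_of_le_one_left (Nat.cast_nonneg _) (by linarith)
  rcases density_dichotomy hε0 hε1 hA0 hB0 hA hB with h | h
  · refine ⟨fun A' hA' B' hB' hcA hcB => ?_, fun A' hA' B' hB' hcA hcB => Or.inl ?_⟩
    · have h1 := h A Subset.rfl B Subset.rfl (hself A) (hself B)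
      have h2 := h A' hA' B' hB' hcA hcB
      have h3 := density_nonneg (G := G) A B
      have h4 := density_nonneg (G := G) A' B'
      rw [abs_lt]; constructor <;> linarith
    · linarith [h A' hA' B' hB' hcA hcB]
  · refine ⟨fun A' hA' B' hB' hcA hcB => ?_, fun A' hA' B' hB' hcA hcB => Or.inr ?_⟩
    · have h1 := h A Subset.rfl B Subset.rfl (hself A) (hself B)
      have h2 := h A' hA' B' hB' hcA hcB
      have h3 := density_le_one (G := G) A B
      have h4 := density_le_one (G := G) A' B'
      rw [abs_lt]; constructor <;> linarith
    · linarith [h A' hA' B' hB' hcA hcB]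

theorem exists_balanced_map {m : ℕ} (hm : 0 < m) (R : Finset V) :
    ∃ f : V → Fin m, (∀ i j, (R.filter (f · = i)).card ≤ (R.filter (f · = j)).card + 1) ∧
      ∀ i, m * (R.filter (f · = i)).card ≤ R.card + m := by
  have : NeZero m := ⟨hm.ne'⟩
  have hbal : ∃ f : V → Fin m, ∀ i j,
      (R.filter (f · = i)).card ≤ (R.filter (f · = j)).card + 1 := by
    induction R using Finset.induction_on with
    | empty => exact ⟨fun _ => 0, by simp⟩
    | insert a R ha ih =>
      obtain ⟨f, hf⟩ := ih
      obtain ⟨k, -, hk⟩ := exists_min_image univ (fun i => (R.filter (f · = i)).card)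
        univ_nonempty
      have hcard : ∀ i, ((insert a R).filter (Function.update f a k · = i)).card =
          (R.filter (f · = i)).card + if k = i then 1 else 0 := by
        intro i
        have hR : R.filter (Function.update f a k · = i) = R.filter (f · = i) :=
          filter_congr fun x hx => by
            rw [Function.update_of_ne (ne_of_mem_of_not_mem hx ha)]
        rw [filter_insert, hR]
        by_cases h : k = i
        · rw [if_pos (by simpa using h), if_pos h, card_insert_of_notMem (by simp [ha])]
        · rw [if_neg (by simpa using h), if_neg h, add_zero]
      refine ⟨Function.update f a k, fun i j => ?_⟩
      rw [hcard, hcard]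
      have h1 := hf i j
      have h2 := hk j (mem_univ _)
      by_cases hi : k = i
      · subst hi
        rw [if_pos rfl]
        omega
      · rw [if_neg hi]
        omega
  obtain ⟨f, hf⟩ := hbal
  refine ⟨f, hf, fun i => ?_⟩
  have hsum : R.card = ∑ j, (R.filter (f · = j)).card :=
    card_eq_sum_card_fiberwise fun _ _ => mem_coe.2 (mem_univ _)
  have hle : ∑ _j : Fin m, (R.filter (f · = i)).card ≤ ∑ j, ((R.filter (f · = j)).card + 1) :=
    sum_le_sum fun j _ => hf i j
  rw [sum_add_distrib, ← hsum] at hle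
  simpa using hle

theorem exists_greedy_packing {p : Finset V → Prop} {c : ℕ} (hc : 0 < c) {T : ℝ} (R : Finset V)
    (h : ∀ R' ⊆ R, T ≤ R'.card → ∃ S ⊆ R', S.card = c ∧ p S) :
    ∃ 𝒮 : Finset (Finset V), (∀ S ∈ 𝒮, S ⊆ R ∧ S.card = c ∧ p S) ∧
      (𝒮 : Set (Finset V)).PairwiseDisjoint id ∧ ((R \ 𝒮.biUnion id).card : ℝ) < T := by
  induction hn : R.card using Nat.strong_induction_on generalizing R with
  | _ n ih =>
  by_cases hT : T ≤ R.card
  · obtain ⟨S, hSR, hSc, hpS⟩ := h R Subset.rfl hT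
    have hcard : (R \ S).card < n := by
      have := card_le_card hSR
      rw [card_sdiff_of_subset hSR]
      omega
    obtain ⟨𝒮, h𝒮, hdisj, hrest⟩ := ih _ hcard (R \ S)
      (fun R' hR' => h R' (hR'.trans sdiff_subset)) rfl
    refine ⟨insert S 𝒮, ?_, ?_, ?_⟩
    · intro S' hS'
      rcases mem_insert.1 hS' with rfl | hS'
      · exact ⟨hSR, hSc, hpS⟩
      · obtain ⟨h1, h2⟩ := h𝒮 S' hS'
        exact ⟨h1.trans sdiff_subset, h2⟩
    · rw [coe_insert]
      refine hdisj.insert fun S' hS' _ => ?_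
      exact (disjoint_sdiff (s := S) (t := R)).mono_right (h𝒮 S' hS').1
    · rwa [biUnion_insert, id, ← sup_eq_union, ← sdiff_sdiff_left]
  · exact ⟨∅, by simp, by simp, by simpa using hT⟩

theorem exists_pow_lt_pow_self {r : ℝ} (hr : 1 < r) (d : ℕ) : ∃ n : ℕ, ((n : ℝ) + 1) ^ d < r ^ n := by
  have hr0 : 0 < r := by linarith
  have h := (isLittleO_pow_const_const_pow_of_one_lt (R := ℝ) d hr).bound
    (show 0 < 1 / (2 * r) by positivity)
  obtain ⟨n, hn, hn1⟩ := (h.and (Filter.eventually_ge_atTop 1)).exists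
  obtain ⟨n, rfl⟩ := Nat.exists_eq_add_of_le' hn1
  refine ⟨n, ?_⟩
  rw [Real.norm_of_nonneg (by positivity), Real.norm_of_nonneg (by positivity)] at hn
  push_cast at hn
  have hpos : 0 < r ^ n := by positivity
  calc _ ≤ _ := hn
    _ = r ^ n / 2 := by field_simp; ring
    _ < r ^ n := by linarith

theorem eventually_mul_pow_lt_exp {C b : ℝ} (hC : 0 < C) (hb : 0 < b) (v : ℕ) (D : ℝ) :
    ∀ᶠ n : ℕ in Filter.atTop, C * ((n : ℝ) + 1) ^ v < Real.exp (b * n - D) := by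
  have h := (isLittleO_pow_exp_pos_mul_atTop v hb).bound
    (show 0 < Real.exp (-D - b) / (2 * C) by positivity)
  have htend : Filter.Tendsto (fun n : ℕ => (n : ℝ) + 1) Filter.atTop Filter.atTop :=
    Filter.tendsto_atTop_add_const_right _ _ tendsto_natCast_atTop_atTop
  filter_upwards [htend.eventually h] with n hn
  rw [Real.norm_of_nonneg (by positivity), Real.norm_of_nonneg (by positivity)] at hn
  have he : Real.exp (b * n - D) = Real.exp (-D - b) * Real.exp (b * (n + 1)) := by
    rw [← Real.exp_add]; congr 1; ring
  calc _ ≤ C * (Real.exp (-D - b) / (2 * C) * Real.exp (b * (n + 1))) := by gcongr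
    _ = Real.exp (b * n - D) / 2 := by rw [he]; field_simp
    _ < _ := half_lt_self (Real.exp_pos _)

/-- Sets of linear size contain an almost constant subset of any prescribed size that is a small
enough proportion of the whole. -/
theorem exists_almostConstant_card_eq [Fintype V] {ε β γ δ : ℝ} {n c N : ℕ} (hβ0 : 0 < β)
    (hβ1 : β ≤ 1) (hn : ∀ s : Multiset V, ¬ AvgTree G ε n s)
    (hδ : 2 * δ = (β / 8) ^ n * γ) (hγN : 0 < γ * N) (hc : c ≤ δ * N)
    (hexp : 2 * (2 ^ n * ((N : ℝ) + 1) ^ 2 ^ n) < Real.exp (β / 2 * c))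
    {R : Finset V} (hRN : R.card ≤ N) (hR : γ * N ≤ R.card) :
    ∃ S ⊆ R, S.card = c ∧ AlmostConstant G β ε S := by
  have hRne : R.Nonempty := by
    rw [← card_pos]
    exact_mod_cast hγN.trans_le hR
  obtain ⟨X, hXR, hXcard, hX⟩ := exists_almostConstant (ε := ε) (α := β / 8) (by linarith)
    (by linarith) hRne (fun s _ => hn s)
  have hXN : X.card ≤ N := (card_le_card hXR).trans hRN
  have h2c : (2 * c : ℝ) ≤ X.card := by
    calc (2 * c : ℝ) ≤ 2 * δ * N := by linarith
      _ = (β / 8) ^ n * (γ * N) := by rw [hδ]; ring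
      _ ≤ (β / 8) ^ n * R.card := by gcongr
      _ ≤ _ := hXcard
  obtain ⟨S, hSX, hS⟩ := hX.exists_subset hn (by exact_mod_cast h2c) (by
    refine lt_of_le_of_lt ?_ hexp
    gcongr)
  exact ⟨S, hSX.trans hXR, hS⟩

/-- An almost covering family of disjoint almost constant sets of the same size can be completed
to an equitable partition into almost constant sets. -/
theorem exists_equipartition {β γ ζ : ℝ} {c : ℕ} (hβ : 0 ≤ β) (hγ : γ ≤ 1 / 2) (hγc : 1 ≤ γ * c)
    {A : Finset V} (hA : A.Nonempty) {𝒮 : Finset (Finset V)}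
    (h𝒮 : ∀ S ∈ 𝒮, S ⊆ A ∧ S.card = c ∧ AlmostConstant G β ζ S)
    (hdisj : (𝒮 : Set (Finset V)).PairwiseDisjoint id)
    (hrest : ((A \ 𝒮.biUnion id).card : ℝ) < γ * A.card) :
    𝒮.card * c ≤ A.card ∧ ∃ P : Fin 𝒮.card → Finset V,
      (∀ i, P i ⊆ A) ∧ (∀ i j, i ≠ j → Disjoint (P i) (P j)) ∧ (∀ a ∈ A, ∃ i, a ∈ P i) ∧
      (∀ i, AlmostConstant G (β + 3 * γ) ζ (P i)) ∧ (∀ i, 0 < (P i).card) ∧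
      ∀ i j, |((P i).card : ℤ) - ((P j).card : ℤ)| ≤ 1 := by
  have hA0 : (0 : ℝ) < A.card := by exact_mod_cast hA.card_pos
  set U := 𝒮.biUnion id
  set R := A \ U
  have hUA : U ⊆ A := biUnion_subset.2 fun S hS => (h𝒮 S hS).1
  have hUcard : U.card = 𝒮.card * c := by
    rw [card_biUnion hdisj]
    exact sum_const_nat fun S hS => (h𝒮 S hS).2.1
  have hsum : R.card + U.card = A.card := card_sdiff_add_card_eq_card hUA
  have hsumR : (R.card : ℝ) + 𝒮.card * c = A.card := by
    rw [hUcard] at hsum; exact_mod_cast hsum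
  refine ⟨by omega, ?_⟩
  have hm : 0 < 𝒮.card := by
    by_contra h
    have h0 : 𝒮.card = 0 := by omega
    rw [h0, Nat.cast_zero, zero_mul, add_zero] at hsumR
    nlinarith
  obtain ⟨f, hf, hfc⟩ := exists_balanced_map hm R
  set e := 𝒮.equivFin.symm
  have he : ∀ i, (e i : Finset V) ⊆ U := fun i => subset_biUnion_of_mem id (e i).2
  have hdisjR : ∀ i j, Disjoint (e i : Finset V) (R.filter (f · = j)) := fun i j =>
    (disjoint_sdiff (s := U) (t := A)).mono (he i) (filter_subset _ _)
  have hcard : ∀ i, ((e i : Finset V) ∪ R.filter (f · = i)).card =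
      c + (R.filter (f · = i)).card := fun i => by
    rw [card_union_of_disjoint (hdisjR i i), (h𝒮 _ (e i).2).2.1]
  have hc : 0 < c := by
    rcases Nat.eq_zero_or_pos c with h | h
    · subst h; norm_num at hγc
    · exact h
  refine ⟨fun i => e i ∪ R.filter (f · = i), ?_, ?_, ?_, ?_, ?_, ?_⟩
  · exact fun i => union_subset ((he i).trans hUA) ((filter_subset _ _).trans sdiff_subset)
  · intro i j hij
    rw [disjoint_union_left, disjoint_union_right, disjoint_union_right]
    refine ⟨⟨hdisj (e i).2 (e j).2 fun h => hij (e.injective (Subtype.ext h)), hdisjR i j⟩,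
      (hdisjR j i).symm, ?_⟩
    rw [disjoint_filter]
    exact fun x _ hi hj => hij (hi.symm.trans hj)
  · intro a ha
    by_cases haU : a ∈ U
    · obtain ⟨S, hS, haS⟩ := mem_biUnion.1 haU
      refine ⟨e.symm ⟨S, hS⟩, mem_union_left _ ?_⟩
      simpa using haS
    · exact ⟨f a, mem_union_right _ (mem_filter.2 ⟨mem_sdiff.2 ⟨ha, haU⟩, rfl⟩)⟩
  · intro i
    refine (h𝒮 _ (e i).2).2.2.union hβ ?_
    rw [(h𝒮 _ (e i).2).2.1]
    have hfi : (𝒮.card : ℝ) * (R.filter (f · = i)).card ≤ R.card + 𝒮.card := by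
      exact_mod_cast hfc i
    have hm' : (0 : ℝ) < 𝒮.card := by exact_mod_cast hm
    have hγ0 : 0 ≤ γ := by
      by_contra h
      have : γ * c ≤ 0 := mul_nonpos_of_nonpos_of_nonneg (by linarith) (Nat.cast_nonneg _)
      linarith
    have hhalf : (A.card : ℝ) ≤ 2 * (𝒮.card * c) := by nlinarith
    refine le_of_mul_le_mul_left ?_ hm'
    have h1 : γ * A.card ≤ γ * (2 * (𝒮.card * c)) := by gcongr
    have h2 : (𝒮.card : ℝ) * 1 ≤ 𝒮.card * (γ * c) := by gcongr
    linarith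
  · intro i
    rw [hcard]
    omega
  · intro i j
    rw [hcard, hcard, abs_le]
    have h1 := hf i j
    have h2 := hf j i
    omega

theorem eventually_parameters {β γ δ : ℝ} (hβ : 0 < β) (hγ : 0 < γ) (hδ : 0 < δ) (n : ℕ) :
    ∀ᶠ N : ℕ in Filter.atTop, 0 < N ∧ 2 ≤ δ * N ∧ 1 ≤ γ * ⌊δ * N⌋₊ ∧
      2 * (2 ^ n * ((N : ℝ) + 1) ^ 2 ^ n) < Real.exp (β / 2 * ⌊δ * N⌋₊) := by
  have hδN : Filter.Tendsto (fun N : ℕ => δ * N) Filter.atTop Filter.atTop :=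
    tendsto_natCast_atTop_atTop.const_mul_atTop hδ
  have hlarge := hδN.eventually_ge_atTop (1 / γ + 1)
  have hexp := eventually_mul_pow_lt_exp (C := 2 * 2 ^ n) (b := β / 2 * δ) (by positivity)
    (by positivity) (2 ^ n) (β / 2)
  filter_upwards [Filter.eventually_gt_atTop 0, hδN.eventually_ge_atTop 2, hlarge, hexp]
    with N h1 h2 h3 h4
  have hfloor : δ * N - 1 < ⌊δ * N⌋₊ := Nat.sub_one_lt_floor _
  refine ⟨h1, h2, ?_, ?_⟩
  · calc 1 = γ * (1 / γ) := by field_simp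
      _ ≤ _ := by gcongr; linarith
  · rw [← mul_assoc]
    refine h4.trans_le (Real.exp_le_exp.2 ?_)
    nlinarith

end Paper

open Paper

theorem stmt1 (ks kss : ℕ) (ε : ℝ) (hε0 : 0 < ε) (hε1 : ε < 1 / 2) :
    ∃ N k : ℕ,
      ∀ (V : Type) [Fintype V] (G : SimpleGraph V),
        NoOrderProp G ks → NoTreeProp G kss →
        ∀ A : Finset V, N ≤ A.card →
          ∃ m : ℕ, m ≤ k ∧
            ∃ P : Fin m → Finset V,
              (∀ i, P i ⊆ A) ∧
              (∀ i j, i ≠ j → Disjoint (P i) (P j)) ∧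
              (∀ a ∈ A, ∃ i, a ∈ P i) ∧
              (∀ i, Excellent G ε ε (P i)) ∧
              ∀ i j : Fin m, i < j →
                |((P i).card : ℤ) - ((P j).card : ℤ)| ≤ 1 ∧
                Regular G ε (P i) (P j) ∧
                ∀ Bi ⊆ P i, ∀ Bj ⊆ P j,
                  ε * (P i).card ≤ (Bi.card : ℝ) → ε * (P j).card ≤ (Bj.card : ℝ) →
                  density G Bi Bj < ε ∨ 1 - ε ≤ density G Bi Bj := by
  have hθ0 : 0 < ε ^ 3 / 4 := by positivity
  have hθε : ε ^ 3 / 4 ≤ ε := by nlinarith [mul_pos hε0 hε0]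
  obtain ⟨n, hn⟩ := exists_pow_lt_pow_self (r := 2 * (1 - ε)) (by linarith) kss
  set β := ε ^ 3 / 8 with hβ
  set γ := ε ^ 3 / 24 with hγ
  set δ := (β / 8) ^ n * γ / 2 with hδ
  have hβ0 : 0 < β := by positivity
  have hγ0 : 0 < γ := by positivity
  have hδ0 : 0 < δ := by positivity
  have hθ : β + 3 * γ = ε ^ 3 / 4 := by rw [hβ, hγ]; ring
  obtain ⟨N, hN⟩ := Filter.eventually_atTop.1 (eventually_parameters hβ0 hγ0 hδ0 n)
  refine ⟨N, ⌈2 / δ⌉₊, fun V _ G _ hG A hA => ?_⟩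
  obtain ⟨hA0, hA2, hγc, hexp⟩ := hN _ hA
  have hA0' : (0 : ℝ) < A.card := by exact_mod_cast hA0
  set c := ⌊δ * A.card⌋₊
  have hc : (c : ℝ) ≤ δ * A.card := Nat.floor_le (by positivity)
  have hc' : δ * A.card - 1 < c := Nat.sub_one_lt_floor _
  have hc0 : 0 < c := by
    have : (0 : ℝ) < c := by linarith
    exact_mod_cast this
  obtain ⟨𝒮, h𝒮, hdisj, hrest⟩ := exists_greedy_packing (p := AlmostConstant G β ε) hc0
    (T := γ * A.card) A fun R hRA hR =>
      exists_almostConstant_card_eq hβ0 (by linarith) (hG.not_avgTree (by linarith) hn)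
        (by rw [hδ]; ring) (by positivity) hc hexp (card_le_card hRA) hR
  obtain ⟨hm, P, hPA, hPdisj, hPcover, hP, hPpos, hPcard⟩ := exists_equipartition hβ0.le
    (by linarith) hγc (card_pos.1 hA0) h𝒮 hdisj hrest
  rw [hθ] at hP
  refine ⟨𝒮.card, ?_, P, hPA, hPdisj, hPcover,
    fun i => (hP i).excellent hε0 (by linarith) hθε, fun i j _ => ⟨hPcard i j, ?_⟩⟩
  · have hm' : (𝒮.card : ℝ) * c ≤ A.card := by exact_mod_cast hm
    have h1 : (𝒮.card : ℝ) * (δ * A.card / 2) ≤ A.card :=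
      le_trans (by gcongr; linarith) hm'
    have h2 : (𝒮.card : ℝ) ≤ 2 / δ := by
      rw [le_div_iff₀ hδ0]
      refine le_of_mul_le_mul_right ?_ hA0'
      linarith
    exact_mod_cast h2.trans (Nat.le_ceil _)
  · exact regular_and_density hε0 hε1 (hPpos i) (hPpos j) (hP i) (hP j)
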